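/- For all words u and v over V, the deconcatenation coproduct is compatible with the shuffle product: Δ(u ⧢ v) = Σ (u¹ ⧢ v¹) ⊗ (u² ⧢ v²), where the sum runs over all pairs of cuts u = u¹u² and v = v¹v² (including empty factors, with 1⧢a = a⧢1 = a). -/

import Mathlib

open Finset MonoidAlgebra TensorProduct

/-- `Sh(p,q)`: permutations of the `p+q` indices that are increasing on the
first `p` indices and on the last `q` indices. -/
def IsSh (p q : ℕ) (σ : Equiv.Perm (Fin (p + q))) : Prop :=
  (∀ i j : Fin (p + q), (i : ℕ) < (j : ℕ) → (j : ℕ) < p → σ i < σ j) ∧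
  (∀ i j : Fin (p + q), p ≤ (i : ℕ) → (i : ℕ) < (j : ℕ) → σ i < σ j)

instance IsSh.decPred (p q : ℕ) : DecidablePred (IsSh p q) := fun _ => by
  unfold IsSh; infer_instance

/-- The word `u_{σ⁻¹(1)} u_{σ⁻¹(2)} ⋯ u_{σ⁻¹(p+q)}` where `u₁ ⋯ u_p` is `u` and
`u_{p+1} ⋯ u_{p+q}` is `v`. -/
def shWord {V : Type*} (u v : List V) (σ : Equiv.Perm (Fin (u.length + v.length))) :
    FreeMonoid V :=
  FreeMonoid.ofList
    (List.ofFn fun i => (u ++ v).get (Fin.cast (List.length_append (as := u) (bs := v)).symm (σ.symm i)))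

/-- `posCond p b i` says that the letter at (combined) index `i` comes from the second
word (`b = true`, i.e. `p ≤ i`) or from the first word (`b = false`, i.e. `i < p`). -/
def posCond (p : ℕ) (b : Bool) (i : ℕ) : Prop :=
  match b with
  | true => p ≤ i
  | false => i < p

instance posCond.dec (p : ℕ) (b : Bool) (i : ℕ) : Decidable (posCond p b i) := by
  cases b <;> unfold posCond <;> infer_instance

variable (k : Type*) [CommRing k] {V : Type*}

/-- The shuffle product `u ⧢ v` of two words, as an element of the monoid algebra
`H` of the free monoid on `V` (sum over all `(p,q)`-shuffles); in particular
`1 ⧢ a = a ⧢ 1 = a`. -/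
noncomputable def shuffleProd (u v : List V) : MonoidAlgebra k (FreeMonoid V) :=
  ∑ σ ∈ univ.filter (IsSh u.length v.length),
    MonoidAlgebra.single (shWord u v σ) (1 : k)

/-- Generic quadri-algebra operation on words: the part of the shuffle product `u ⧢ v`
consisting of the shuffles where the first (resp. last) letter comes from `v` iff `fb`
(resp. `lb`) is `true`.  (For a shuffle permutation, the first letter comes from `v`
iff `σ⁻¹(1) = p+1`, and from `u` iff `σ⁻¹(1) = 1`; the last letter comes from `v` iff
`σ⁻¹(p+q) = p+q`, and from `u` iff `σ⁻¹(p+q) = p`.)  This definition also encodes the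
empty-word conventions: `1 ↘ a = a` and `a ↖ 1 = a` for nonempty `a`, and all other
quadri-algebra operations with an empty argument are `0`. -/
noncomputable def quadOp (fb lb : Bool) (u v : List V) : MonoidAlgebra k (FreeMonoid V) :=
  ∑ σ ∈ univ.filter (fun σ : Equiv.Perm (Fin (u.length + v.length)) =>
      IsSh u.length v.length σ ∧
      ∃ h : 0 < u.length + v.length,
        posCond u.length fb (σ.symm ⟨0, h⟩) ∧
        posCond u.length lb (σ.symm ⟨u.length + v.length - 1, Nat.sub_lt h Nat.one_pos⟩)),
    MonoidAlgebra.single (shWord u v σ) (1 : k)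

/-- `u ↘ v` : shuffles whose first and last letters come from `v`. -/
noncomputable def seOp (u v : List V) : MonoidAlgebra k (FreeMonoid V) := quadOp k true true u v

/-- `u ↗ v` : shuffles whose first letter comes from `v` and last letter from `u`. -/
noncomputable def neOp (u v : List V) : MonoidAlgebra k (FreeMonoid V) := quadOp k true false u v

/-- `u ↖ v` : shuffles whose first and last letters come from `u`. -/
noncomputable def nwOp (u v : List V) : MonoidAlgebra k (FreeMonoid V) := quadOp k false false u v

/-- `u ↙ v` : shuffles whose first letter comes from `u` and last letter from `v`. -/
noncomputable def swOp (u v : List V) : MonoidAlgebra k (FreeMonoid V) := quadOp k false true u v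

/-- `u ≻ v := u ↗ v + u ↘ v`. -/
noncomputable def succOp (u v : List V) : MonoidAlgebra k (FreeMonoid V) := neOp k u v + seOp k u v

/-- `u ≺ v := u ↖ v + u ↙ v`. -/
noncomputable def precOp (u v : List V) : MonoidAlgebra k (FreeMonoid V) := nwOp k u v + swOp k u v

/-- `u ∨ v := u ↘ v + u ↙ v`. -/
noncomputable def veeOp (u v : List V) : MonoidAlgebra k (FreeMonoid V) := seOp k u v + swOp k u v

/-- `u ∧ v := u ↗ v + u ↖ v`. -/
noncomputable def wedgeOp (u v : List V) : MonoidAlgebra k (FreeMonoid V) := neOp k u v + nwOp k u v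

/-- Deconcatenation coproduct `Δ(u) = Σ_{u = u¹u²} u¹ ⊗ u²`, extended `k`-linearly. -/
noncomputable def deconc (x : MonoidAlgebra k (FreeMonoid V)) :
    MonoidAlgebra k (FreeMonoid V) ⊗[k] MonoidAlgebra k (FreeMonoid V) :=
  Finsupp.sum x.coeff fun a ca =>
    ca • ∑ i ∈ Finset.range ((FreeMonoid.toList a).length + 1),
      (MonoidAlgebra.single (FreeMonoid.ofList ((FreeMonoid.toList a).take i)) (1 : k)) ⊗ₜ[k]
        (MonoidAlgebra.single (FreeMonoid.ofList ((FreeMonoid.toList a).drop i)) (1 : k))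


/-- Recursive list of shuffles. -/
def shufL {α : Type*} : List α → List α → List (List α)
  | [], v => [v]
  | a :: u, [] => [a :: u]
  | a :: u, b :: v => (shufL u (b :: v)).map (a :: ·) ++ (shufL (a :: u) v).map (b :: ·)
termination_by u v => u.length + v.length

theorem shufL_nil_left {α : Type*} (v : List α) : shufL [] v = [v] := by rw [shufL]

theorem shufL_nil_right {α : Type*} (u : List α) : shufL u [] = [u] := by
  cases u <;> rw [shufL]

theorem shufL_cons {α : Type*} (a b : α) (u v : List α) : shufL (a :: u) (b :: v) =
    (shufL u (b :: v)).map (a :: ·) ++ (shufL (a :: u) v).map (b :: ·) := by rw [shufL]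

theorem shufL_map {α β : Type*} (f : α → β) (u v : List α) :
    shufL (u.map f) (v.map f) = (shufL u v).map (List.map f) := by
  induction u generalizing v with
  | nil => simp [shufL_nil_left]
  | cons a u ihu =>
    induction v with
    | nil => simp [shufL_nil_right]
    | cons b v ihv =>
      have h := ihu (b :: v)
      simp only [List.map_cons] at h ihv
      simp only [List.map_cons, shufL_cons, h, ihv, List.map_append, List.map_map]
      rfl

theorem mem_shufL {α : Type*} (P : α → Prop) [DecidablePred P] (L A B : List α)
    (hA : ∀ a ∈ A, P a) (hB : ∀ b ∈ B, ¬ P b) :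
    L ∈ shufL A B ↔ L.filter (fun x => decide (P x)) = A ∧
      L.filter (fun x => decide (¬ P x)) = B := by
  induction A generalizing L B with
  | nil =>
    rw [shufL_nil_left, List.mem_singleton]
    constructor
    · rintro rfl
      exact ⟨by simpa using hB, by simpa using hB⟩
    · rintro ⟨h1, h2⟩
      rw [← h2]; symm
      simpa using h1
  | cons a u ihu =>
    induction B generalizing L with
    | nil =>
      rw [shufL_nil_right, List.mem_singleton]
      constructor
      · rintro rfl
        exact ⟨by simpa using hA, by simpa using hA⟩
      · rintro ⟨h1, h2⟩
        rw [← h1]; symm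
        simpa using h2
    | cons b v ihv =>
      have ha : P a := hA a (by simp)
      have hb : ¬ P b := hB b (by simp)
      rw [shufL_cons]
      cases L with
      | nil => simp
      | cons c L =>
        have h1 := ihu L (b :: v) (fun x hx => hA x (by simp [hx])) hB
        have h2 := ihv L (fun x hx => hB x (by simp [hx]))
        simp only [List.mem_append, List.mem_map, List.cons.injEq, List.filter_cons]
        by_cases hc : P c
        · have : b ≠ c := fun h => hb (h ▸ hc)
          simp only [hc, not_true_eq_false, decide_true, decide_false, if_true, this, false_and,
            and_false, exists_false, or_false, List.cons.injEq]
          constructor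
          · rintro ⟨x, hx, rfl, rfl⟩
            have := h1.1 hx
            exact ⟨⟨rfl, this.1⟩, by simpa using this.2⟩
          · rintro ⟨⟨rfl, h3⟩, h4⟩
            exact ⟨L, h1.2 ⟨h3, by simpa using h4⟩, rfl, rfl⟩
        · have : a ≠ c := fun h => hc (h ▸ ha)
          simp only [hc, not_false_eq_true, decide_true, decide_false, if_true, this, false_and,
            and_false, exists_false, false_or, List.cons.injEq]
          constructor
          · rintro ⟨x, hx, rfl, rfl⟩
            have := h2.1 hx
            exact ⟨by simpa using this.1, rfl, this.2⟩
          · rintro ⟨h3, rfl, h4⟩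
            exact ⟨L, h2.2 ⟨by simpa using h3, h4⟩, rfl, rfl⟩

theorem nodup_shufL {α : Type*} (A B : List α) (h : A.Disjoint B) : (shufL A B).Nodup := by
  induction A generalizing B with
  | nil => simp [shufL_nil_left]
  | cons a u ihu =>
    induction B with
    | nil => simp [shufL_nil_right]
    | cons b v ihv =>
      have hab : a ≠ b := fun e => h (a := a) (by simp) (by simp [e])
      rw [shufL_cons]
      refine List.Nodup.append ?_ ?_ ?_
      · exact (ihu _ (fun x hx hy => h (by simp [hx]) hy)).map List.cons_injective
      · exact (ihv (fun x hx hy => h hx (by simp [hy]))).map List.cons_injective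
      · intro x hx hy
        simp only [List.mem_map] at hx hy
        obtain ⟨s, -, rfl⟩ := hx
        obtain ⟨t, -, ht⟩ := hy
        exact hab (by injection ht with h1 h2; exact h1.symm)

theorem filter_ofFn_iff {n : ℕ} (σ : Equiv.Perm (Fin n)) (P : Fin n → Prop) [DecidablePred P] :
    (List.ofFn σ.symm).filter (fun x => decide (P x)) =
      (List.finRange n).filter (fun x => decide (P x)) ↔
    ∀ i j : Fin n, i < j → P i → P j → σ i < σ j := by
  have hperm : (List.ofFn σ.symm).Perm (List.finRange n) := by
    rw [List.perm_ext_iff_of_nodup (List.nodup_ofFn.2 σ.symm.injective) (List.nodup_finRange n)]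
    intro a
    simp only [List.mem_ofFn, List.mem_finRange, iff_true]
    exact ⟨σ a, by simp⟩
  have hs : ((List.finRange n).filter (fun x => decide (P x))).Pairwise (· < ·) :=
    (List.pairwise_lt_finRange n).filter _
  have key : (List.ofFn σ.symm).filter (fun x => decide (P x)) =
      (List.finRange n).filter (fun x => decide (P x)) ↔
      ((List.ofFn σ.symm).filter (fun x => decide (P x))).Pairwise (· < ·) := by
    constructor
    · intro h; rw [h]; exact hs
    · intro h
      exact List.Perm.eq_of_pairwise (fun a b _ _ h1 h2 => absurd h1 (lt_asymm h2)) h hs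
        (hperm.filter _)
  rw [key, List.pairwise_filter, List.pairwise_ofFn]
  constructor
  · intro h i j hij hi hj
    by_contra hc
    have hne : σ j ≠ σ i := fun e => hij.ne' (σ.injective e)
    have := h (lt_of_le_of_ne (not_lt.1 hc) hne) (by simpa using hj) (by simpa using hi)
    simp only [Equiv.symm_apply_apply] at this
    exact lt_asymm hij this
  · intro h i j hij hi hj
    by_contra hc
    have hne : σ.symm j ≠ σ.symm i := fun e => hij.ne' (σ.symm.injective e)
    have := h _ _ (lt_of_le_of_ne (not_lt.1 hc) hne) (by simpa using hj) (by simpa using hi)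
    simp only [Equiv.apply_symm_apply] at this
    exact lt_asymm hij this

theorem isSh_iff_mem (p q : ℕ) (σ : Equiv.Perm (Fin (p + q))) :
    IsSh p q σ ↔ List.ofFn σ.symm ∈
      shufL ((List.finRange (p + q)).filter (fun x : Fin (p + q) => decide ((x : ℕ) < p)))
        ((List.finRange (p + q)).filter (fun x : Fin (p + q) => decide (¬ (x : ℕ) < p))) := by
  rw [mem_shufL (fun x : Fin (p + q) => (x : ℕ) < p) _ _ _ (by simp) (by simp),
    filter_ofFn_iff σ (fun x => (x : ℕ) < p), filter_ofFn_iff σ (fun x => ¬ (x : ℕ) < p)]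
  unfold IsSh
  constructor
  · rintro ⟨h1, h2⟩
    exact ⟨fun i j hij _ hj => h1 i j hij hj, fun i j hij hi _ => h2 i j (by omega) hij⟩
  · rintro ⟨h1, h2⟩
    exact ⟨fun i j hij hj => h1 i j hij (by omega) hj,
      fun i j hi hij => h2 i j hij (by omega) (by omega)⟩

theorem finRange_filter_lt (p q : ℕ) :
    (List.finRange (p + q)).filter (fun x : Fin (p + q) => decide ((x : ℕ) < p)) =
      List.ofFn (fun i : Fin p => Fin.castAdd q i) := by
  rw [← List.ofFn_id, List.ofFn_add]
  rw [List.filter_append, List.filter_eq_self.2, List.filter_eq_nil_iff.2]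
  · simp; rfl
  · simp [List.mem_ofFn]
  · simp [List.mem_ofFn]

theorem finRange_filter_ge (p q : ℕ) :
    (List.finRange (p + q)).filter (fun x : Fin (p + q) => decide (¬ (x : ℕ) < p)) =
      List.ofFn (fun i : Fin q => Fin.natAdd p i) := by
  rw [← List.ofFn_id, List.ofFn_add]
  rw [List.filter_append, List.filter_eq_nil_iff.2, List.filter_eq_self.2]
  · simp
  · simp [List.mem_ofFn]
  · simp [List.mem_ofFn]

theorem sum_sh {M : Type*} [AddCommMonoid M] (p q : ℕ) (F : List (Fin (p + q)) → M) :
    ∑ σ ∈ univ.filter (IsSh p q), F (List.ofFn σ.symm) =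
      ((shufL ((List.finRange (p + q)).filter (fun x : Fin (p + q) => decide ((x : ℕ) < p)))
        ((List.finRange (p + q)).filter (fun x : Fin (p + q) => decide (¬ (x : ℕ) < p)))).map F).sum := by
  rw [← List.sum_toFinset]
  · refine Finset.sum_bij (fun σ _ => List.ofFn σ.symm) ?_ ?_ ?_ ?_
    · intro σ hσ
      simpa only [List.mem_toFinset, ← isSh_iff_mem, mem_filter, mem_univ, true_and] using hσ
    · intro σ _ τ _ h
      have := List.ofFn_injective h
      exact Equiv.symm_bijective.injective (DFunLike.coe_injective this)
    · intro L hL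
      rw [List.mem_toFinset] at hL
      have hL' := hL
      rw [mem_shufL (fun x : Fin (p + q) => (x : ℕ) < p) _ _ _ (by simp) (by simp)] at hL
      have hperm : L.Perm (List.finRange (p + q)) := by
        have e1 := List.filter_append_perm (fun x : Fin (p + q) => decide ((x : ℕ) < p)) L
        have e2 := List.filter_append_perm (fun x : Fin (p + q) => decide ((x : ℕ) < p))
          (List.finRange (p + q))
        simp only [← decide_not] at e1 e2
        rw [hL.1, hL.2] at e1
        exact e1.symm.trans e2
      have hlen : L.length = p + q := by simpa using hperm.length_eq
      have hnd : L.Nodup := hperm.nodup_iff.2 (List.nodup_finRange _)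
      have hinj : Function.Injective (fun i : Fin (p + q) => L.get (Fin.cast hlen.symm i)) :=
        fun i j h => by simpa using hnd.injective_get h
      let τ : Equiv.Perm (Fin (p + q)) :=
        Equiv.ofBijective _ (Finite.injective_iff_bijective.1 hinj)
      have hτ : List.ofFn τ = L := by
        apply List.ext_get
        · simp [hlen]
        · intro i h1 h2
          simp [τ]
      refine ⟨τ.symm, ?_, ?_⟩
      · rw [mem_filter, isSh_iff_mem, Equiv.symm_symm, hτ]
        exact ⟨mem_univ _, hL'⟩
      · rw [Equiv.symm_symm, hτ]
    · intros; rfl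
  · apply nodup_shufL
    intro x hx hy
    simp at hx hy
    omega

theorem shuffleProd_eq (u v : List V) : shuffleProd k u v =
    ((shufL u v).map (fun w => MonoidAlgebra.single (FreeMonoid.ofList w) (1 : k))).sum := by
  let f : Fin (u.length + v.length) → V := fun i =>
    (u ++ v).get (Fin.cast (List.length_append (as := u) (bs := v)).symm i)
  have h := sum_sh u.length v.length
    (fun L => MonoidAlgebra.single (FreeMonoid.ofList (L.map f)) (1 : k))
  have hu : (List.ofFn (fun i : Fin u.length => Fin.castAdd v.length i)).map f = u := by
    apply List.ext_get
    · simp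
    · intro i h1 h2
      have h3 : i < u.length := h2
      simp [f, List.getElem_append_left h3]
  have hv : (List.ofFn (fun i : Fin v.length => Fin.natAdd u.length i)).map f = v := by
    apply List.ext_get
    · simp
    · intro i h1 h2
      simp [f]
  have e : shufL u v = (shufL ((List.finRange (u.length + v.length)).filter
      (fun x : Fin (u.length + v.length) => decide ((x : ℕ) < u.length)))
        ((List.finRange (u.length + v.length)).filter
          (fun x : Fin (u.length + v.length) => decide (¬ (x : ℕ) < u.length)))).map (List.map f) := by
    rw [← shufL_map, finRange_filter_lt, finRange_filter_ge, hu, hv]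
  rw [e, List.map_map]
  refine Eq.trans ?_ h
  unfold shuffleProd
  refine Finset.sum_congr rfl fun σ _ => ?_
  unfold shWord
  rw [List.map_ofFn]
  rfl

/-- A letter as an element of the algebra. -/
noncomputable def letterX (a : V) : MonoidAlgebra k (FreeMonoid V) :=
  MonoidAlgebra.single (FreeMonoid.of a) (1 : k)

theorem letterX_mul_single (a : V) (w : List V) :
    letterX k a * MonoidAlgebra.single (FreeMonoid.ofList w) (1 : k) =
      MonoidAlgebra.single (FreeMonoid.ofList (a :: w)) (1 : k) := by
  unfold letterX
  rw [MonoidAlgebra.single_mul_single, one_mul, FreeMonoid.ofList_cons]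

theorem shuffleProd_nil_left (v : List V) :
    shuffleProd k [] v = MonoidAlgebra.single (FreeMonoid.ofList v) (1 : k) := by
  simp [shuffleProd_eq, shufL_nil_left]

theorem shuffleProd_nil_right (v : List V) :
    shuffleProd k v [] = MonoidAlgebra.single (FreeMonoid.ofList v) (1 : k) := by
  simp [shuffleProd_eq, shufL_nil_right]

theorem shuffleProd_cons (a b : V) (u v : List V) :
    shuffleProd k (a :: u) (b :: v) =
      letterX k a * shuffleProd k u (b :: v) + letterX k b * shuffleProd k (a :: u) v := by
  simp only [shuffleProd_eq, shufL_cons, List.map_append, List.sum_append, List.map_map,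
    ← List.sum_map_mul_left]
  simp only [Function.comp_def, letterX_mul_single]

/-- Deconcatenation on a word. -/
noncomputable def deconcW (w : List V) :
    MonoidAlgebra k (FreeMonoid V) ⊗[k] MonoidAlgebra k (FreeMonoid V) :=
  ∑ i ∈ Finset.range (w.length + 1),
      (MonoidAlgebra.single (FreeMonoid.ofList (w.take i)) (1 : k)) ⊗ₜ[k]
        (MonoidAlgebra.single (FreeMonoid.ofList (w.drop i)) (1 : k))

theorem deconc_single (w : List V) :
    deconc k (MonoidAlgebra.single (FreeMonoid.ofList w) (1 : k)) = deconcW k w := by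
  unfold deconc deconcW
  rw [MonoidAlgebra.coeff_single, Finsupp.sum_single_index]
  · simp
  · simp

theorem deconc_add (x y : MonoidAlgebra k (FreeMonoid V)) :
    deconc k (x + y) = deconc k x + deconc k y := by
  unfold deconc
  rw [MonoidAlgebra.coeff_add, Finsupp.sum_add_index']
  · simp
  · intros; rw [add_smul]

theorem deconc_zero : deconc k (0 : MonoidAlgebra k (FreeMonoid V)) = 0 := by
  simp [deconc]

/-- Left multiplication by a letter on the first tensor factor. -/
noncomputable def leftX (a : V) :
    MonoidAlgebra k (FreeMonoid V) ⊗[k] MonoidAlgebra k (FreeMonoid V) →ₗ[k]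
    MonoidAlgebra k (FreeMonoid V) ⊗[k] MonoidAlgebra k (FreeMonoid V) :=
  TensorProduct.map (LinearMap.mulLeft k (letterX k a)) LinearMap.id

theorem leftX_tmul (a : V) (x y : MonoidAlgebra k (FreeMonoid V)) :
    leftX k a (x ⊗ₜ[k] y) = (letterX k a * x) ⊗ₜ[k] y := by
  simp [leftX]

theorem deconcW_cons (a : V) (w : List V) : deconcW k (a :: w) =
    MonoidAlgebra.single (FreeMonoid.ofList []) (1 : k) ⊗ₜ[k]
      MonoidAlgebra.single (FreeMonoid.ofList (a :: w)) (1 : k) + leftX k a (deconcW k w) := by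
  unfold deconcW
  rw [List.length_cons, Finset.sum_range_succ', add_comm, map_sum]
  simp only [List.take_zero, List.drop_zero, List.take_succ_cons, List.drop_succ_cons,
    leftX_tmul, letterX_mul_single]

theorem deconc_shuffle (u v : List V) : deconc k (shuffleProd k u v) =
    ((shufL u v).map (deconcW k)).sum := by
  rw [shuffleProd_eq]
  induction shufL u v with
  | nil => simp [deconc_zero]
  | cons w l ih =>
    rw [List.map_cons, List.sum_cons, deconc_add, ih, deconc_single, List.map_cons, List.sum_cons]

theorem deconc_letterX_mul (a : V) (l : List (List V)) :
    ((l.map (a :: ·)).map (deconcW k)).sum =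
    MonoidAlgebra.single (FreeMonoid.ofList []) (1 : k) ⊗ₜ[k]
      (letterX k a *
        (l.map (fun w => MonoidAlgebra.single (FreeMonoid.ofList w) (1 : k))).sum) +
      leftX k a ((l.map (deconcW k)).sum) := by
  induction l with
  | nil => simp
  | cons w l ih =>
    simp only [List.map_cons, List.sum_cons, ih, deconcW_cons, mul_add, TensorProduct.tmul_add,
      map_add, letterX_mul_single]
    abel

theorem deconc_shuffle_cons (a b : V) (u v : List V) :
    deconc k (shuffleProd k (a :: u) (b :: v)) =
      MonoidAlgebra.single (FreeMonoid.ofList []) (1 : k) ⊗ₜ[k] shuffleProd k (a :: u) (b :: v)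
      + leftX k a (deconc k (shuffleProd k u (b :: v)))
      + leftX k b (deconc k (shuffleProd k (a :: u) v)) := by
  rw [deconc_shuffle, shufL_cons, List.map_append, List.sum_append, deconc_letterX_mul,
    deconc_letterX_mul, ← deconc_shuffle, ← deconc_shuffle, ← shuffleProd_eq, ← shuffleProd_eq,
    shuffleProd_cons, TensorProduct.tmul_add]
  abel

/-- `Δ(u ⧢ v) = Σ (u¹ ⧢ v¹) ⊗ (u² ⧢ v²)`, sum over all pairs of cuts. -/
theorem statement19 (u v : List V) :
    deconc k (shuffleProd k u v) =
      ∑ p ∈ Finset.range (u.length + 1) ×ˢ Finset.range (v.length + 1),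
        (shuffleProd k (u.take p.1) (v.take p.2)) ⊗ₜ[k]
          (shuffleProd k (u.drop p.1) (v.drop p.2)) := by
  rw [Finset.sum_product]
  induction u generalizing v with
  | nil =>
    simp [shuffleProd_nil_left, deconc_single, deconcW]
  | cons a u ihu =>
    induction v with
    | nil =>
      rw [shuffleProd_nil_right, deconc_single]
      simp [shuffleProd_nil_right, deconcW]
    | cons b v ihv =>
      rw [deconc_shuffle_cons, ihu, ihv]
      simp only [List.length_cons, map_sum, leftX_tmul]
      rw [Finset.sum_range_succ' _ (u.length + 1), Finset.sum_range_succ' _ (u.length + 1)]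
      simp only [Finset.sum_range_succ' _ (v.length + 1), List.take_zero, List.drop_zero,
        List.take_succ_cons, List.drop_succ_cons, shuffleProd_cons, shuffleProd_nil_left,
        shuffleProd_nil_right, letterX_mul_single, TensorProduct.add_tmul,
        Finset.sum_add_distrib]
      abel
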